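/- arXiv:2511.09267 — 4 statements merged into one kernel-verified Lean document; each statement's English description precedes it below -/
import Mathlib

section
/- Let G be a group, E a complex Hilbert space, g a positive integer, and w ∈ ⟨x⟩_g. Let s denote the immediate successor of w in the shortlex order on ⟨x⟩_g. If χ : Her W_{≤w} → (G → B(E)) is a positive semidefinite w-partially defined form, then there exists a function χ̃ : Her W_{≤s} → (G → B(E)) whose restriction to Her W_{≤w} equals χ and which is a positive semidefinite s-partially defined form, i.e., for every family (f_v)_{v ∈ W_{≤s}} of finitely supported functions G → E, the sum Σ_{u,v ∈ W_{≤s}} Σ_{g₁,h₁ ∈ G} ⟨ χ̃(u⁻¹v)(g₁⁻¹h₁) f_v(h₁), f_u(g₁) ⟩ is real and nonnegative. -/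
open scoped ComplexInnerProductSpace

/-- The strict shortlex order on words over the alphabet `Fin n`. -/
def ShortlexLT {n : ℕ} (a b : List (Fin n)) : Prop :=
  a.length < b.length ∨ (a.length = b.length ∧ List.Lex (· < ·) a b)

/-- The shortlex order on words over the alphabet `Fin n`. -/
def ShortlexLE {n : ℕ} (a b : List (Fin n)) : Prop :=
  ShortlexLT a b ∨ a = b

/-- The image of a word in the free group. -/
def wordF {g : ℕ} (l : List (Fin g)) : FreeGroup (Fin g) :=
  (l.map FreeGroup.of).prod

/-- `W_{≤ w}`: the image in the free group of the set of words `≤ w` in shortlex. -/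
def WleF {g : ℕ} (w : List (Fin g)) : Set (FreeGroup (Fin g)) :=
  {a | ∃ l : List (Fin g), ShortlexLE l w ∧ wordF l = a}

/-- `Her W_{≤ w} = {u⁻¹ v : u, v ∈ W_{≤ w}}`. -/
def HerWleF {g : ℕ} (w : List (Fin g)) : Set (FreeGroup (Fin g)) :=
  {α | ∃ u ∈ WleF w, ∃ v ∈ WleF w, u⁻¹ * v = α}

/-- A partially defined form `χ`, with values functions `G → B(E)`, is positive
semidefinite relative to the index set `Wset`. -/
def FormPSD {g : ℕ} {G : Type*} [Group G] {E : Type*}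
    [NormedAddCommGroup E] [InnerProductSpace ℂ E]
    (Wset : Set (FreeGroup (Fin g)))
    (χ : FreeGroup (Fin g) → G → (E →L[ℂ] E)) : Prop :=
  ∀ f : FreeGroup (Fin g) → G →₀ E,
    0 ≤ (∑ᶠ u ∈ Wset, ∑ᶠ v ∈ Wset, ∑ᶠ g₁ : G, ∑ᶠ h₁ : G,
          ⟪f u g₁, χ (u⁻¹ * v) (g₁⁻¹ * h₁) (f v h₁)⟫).re ∧
    (∑ᶠ u ∈ Wset, ∑ᶠ v ∈ Wset, ∑ᶠ g₁ : G, ∑ᶠ h₁ : G,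
          ⟪f u g₁, χ (u⁻¹ * v) (g₁⁻¹ * h₁) (f v h₁)⟫).im = 0

/-- If `u⁻¹ s` is a reduced quotient of positive words, any other expression `p⁻¹ q` of it arises
from a common prefix. -/
theorem exists_append_of_inv_mul_eq {g : ℕ} {u s : List (Fin g)}
    (hus : ∀ a ∈ u.head?, ∀ b ∈ s.head?, a ≠ b) :
    ∀ {p q : List (Fin g)}, (wordF p)⁻¹ * wordF q = (wordF u)⁻¹ * wordF s →
      ∃ r, p = r ++ u ∧ q = r ++ s := by
  have mk_eq (l : List (Fin g)) : wordF l = FreeGroup.mk (l.map (·, true)) := by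
    induction l with
    | nil => rfl
    | cons a l ih =>
      change FreeGroup.of a * wordF l = _
      rw [ih, FreeGroup.of, FreeGroup.mul_mk]
      rfl
  have mk_inv (p q : List (Fin g)) : (wordF p)⁻¹ * wordF q =
      FreeGroup.mk (p.reverse.map (·, false) ++ q.map (·, true)) := by
    rw [mk_eq, mk_eq, FreeGroup.inv_mk, FreeGroup.mul_mk]
    simp [FreeGroup.invRev, Function.comp_def]
  have chain (b : Bool) (l : List (Fin g)) : FreeGroup.IsReduced (l.map (·, b)) := by
    rw [FreeGroup.IsReduced, List.isChain_map, List.isChain_iff_forall_rel_of_append_cons_cons]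
    simp
  have reduced {p q : List (Fin g)} (h : ∀ a ∈ p.head?, ∀ b ∈ q.head?, a ≠ b) :
      FreeGroup.IsReduced (p.reverse.map (·, false) ++ q.map (·, true)) := by
    refine List.IsChain.append (chain _ _) (chain _ _) ?_
    intro x hx y hy hxy
    simp only [List.map_reverse, List.getLast?_reverse, List.head?_map, Option.mem_def,
      Option.map_eq_some_iff] at hx hy
    obtain ⟨a, ha, rfl⟩ := hx
    obtain ⟨b, hb, rfl⟩ := hy
    exact absurd hxy (h a ha b hb)
  have base {p q : List (Fin g)} (h : ∀ a ∈ p.head?, ∀ b ∈ q.head?, a ≠ b)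
      (e : (wordF p)⁻¹ * wordF q = (wordF u)⁻¹ * wordF s) : p = u ∧ q = s := by
    rw [mk_inv, mk_inv] at e
    have e' := congrArg FreeGroup.toWord e
    rw [FreeGroup.toWord_mk, FreeGroup.toWord_mk, (reduced h).reduce_eq,
      (reduced hus).reduce_eq] at e'
    have h1 := congrArg (fun l => (l.filter (fun x => x.2)).map Prod.fst) e'
    have h2 := congrArg (fun l => (l.filter (fun x => !x.2)).map Prod.fst) e'
    simp [List.filter_map, Function.comp_def] at h1 h2
    exact ⟨h2, h1⟩
  intro p
  induction p with
  | nil =>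
    intro q e
    obtain ⟨h1, h2⟩ := base (by simp) e
    exact ⟨[], h1, h2⟩
  | cons a p ih =>
    intro q e
    cases q with
    | nil =>
      obtain ⟨h1, h2⟩ := base (by simp) e
      exact ⟨[], h1, h2⟩
    | cons b q =>
      by_cases hab : a = b
      · subst hab
        obtain ⟨r, rfl, rfl⟩ := ih (q := q) (by
          rw [← e]
          simp [wordF, mul_assoc])
        exact ⟨a :: r, rfl, rfl⟩
      · obtain ⟨h1, h2⟩ := base (by simpa using hab) e
        exact ⟨[], h1, h2⟩

theorem wordF_injective {g : ℕ} : Function.Injective (wordF (g := g)) := by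
  intro p q h
  obtain ⟨r, rfl, rfl⟩ := exists_append_of_inv_mul_eq (u := []) (s := []) (p := p) (q := q)
    (by simp) (by simp [h])
  rfl

theorem shortlexLT_trichotomy {n : ℕ} (a b : List (Fin n)) :
    ShortlexLT a b ∨ a = b ∨ ShortlexLT b a := by
  have := (inferInstance : Std.Trichotomous
    (List.Shortlex ((· < ·) : Fin n → Fin n → Prop))).trichotomous a b
  simp only [List.shortlex_def] at this
  unfold ShortlexLT
  tauto

theorem shortlexLT_asymm {n : ℕ} {a b : List (Fin n)} (h : ShortlexLT a b) :
    ¬ ShortlexLT b a := by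
  have := (inferInstance : Std.Asymm
    (List.Shortlex ((· < ·) : Fin n → Fin n → Prop))).asymm a b
  simp only [List.shortlex_def] at this
  exact this h

theorem ShortlexLE.length_le {n : ℕ} {a b : List (Fin n)} (h : ShortlexLE a b) :
    a.length ≤ b.length := by
  rcases h with (h | h) | rfl
  · exact h.le
  · exact h.1.le
  · rfl

theorem shortlexLE_of_not_lt {n : ℕ} {a b : List (Fin n)} (h : ¬ ShortlexLT a b) :
    ShortlexLE b a := by
  rcases shortlexLT_trichotomy a b with h' | rfl | h'
  · exact absurd h' h
  · exact Or.inr rfl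
  · exact Or.inl h'

theorem finite_WleF {g : ℕ} (w : List (Fin g)) : (WleF w).Finite := by
  refine ((List.finite_length_le (Fin g) w.length).image wordF).subset ?_
  rintro _ ⟨l, hl, rfl⟩
  exact ⟨l, hl.length_le, rfl⟩

theorem not_append_shortlexLE {g : ℕ} {w s : List (Fin g)} (hlt : ShortlexLT w s)
    (r : List (Fin g)) : ¬ ShortlexLE (r ++ s) w := by
  intro h
  cases r with
  | nil =>
    rcases h with h | h
    · exact shortlexLT_asymm hlt h
    · exact shortlexLT_asymm hlt (by simpa [← h] using hlt)
  | cons a r =>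
    have h1 := h.length_le
    have h2 := ShortlexLE.length_le (Or.inl hlt)
    simp at h1
    omega

theorem wordF_notMem_WleF {g : ℕ} {w s : List (Fin g)} (hlt : ShortlexLT w s) :
    wordF s ∉ WleF w := by
  rintro ⟨l, hl, h⟩
  rw [wordF_injective h] at hl
  exact not_append_shortlexLE hlt [] hl

theorem WleF_subset_insert {g : ℕ} {w s : List (Fin g)}
    (hsucc : ∀ v : List (Fin g), ShortlexLT w v → ShortlexLE s v) :
    WleF s ⊆ insert (wordF s) (WleF w) := by
  rintro _ ⟨l, hl, rfl⟩
  by_cases h : ShortlexLT w l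
  · left
    rcases hl with hl | rfl
    · rcases hsucc l h with h' | rfl
      · exact absurd h' (shortlexLT_asymm hl)
      · rfl
    · rfl
  · exact Or.inr ⟨l, shortlexLE_of_not_lt h, rfl⟩

theorem exists_eq_of_mul_of_inv_mul_eq {g : ℕ} {w s' : List (Fin g)} {x : Fin g}
    (hlt : ShortlexLT w (x :: s')) {u p q : FreeGroup (Fin g)} (hu : u ∈ WleF w)
    (hq : q ∈ WleF w) (hp : ∃ l, wordF l = p) (h : p⁻¹ * q = u⁻¹ * wordF (x :: s')) :
    ∃ v ∈ WleF w, u = FreeGroup.of x * v := by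
  obtain ⟨q, hq, rfl⟩ := hq
  obtain ⟨p, rfl⟩ := hp
  obtain ⟨u, hu, rfl⟩ := hu
  by_cases hus : ∀ a ∈ u.head?, ∀ b ∈ (x :: s').head?, a ≠ b
  · obtain ⟨r, -, rfl⟩ := exists_append_of_inv_mul_eq hus h
    exact absurd hq (not_append_shortlexLE hlt r)
  · cases u with
    | nil => simp at hus
    | cons a u =>
      obtain rfl : a = x := by simpa using hus
      refine ⟨wordF u, ⟨u, Or.inl (Or.inl ?_), rfl⟩, rfl⟩
      have := hu.length_le
      simp at this
      omega

theorem wordF_tail_mem_WleF {g : ℕ} {w s' : List (Fin g)} {x : Fin g}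
    (hsucc : ∀ v : List (Fin g), ShortlexLT w v → ShortlexLE (x :: s') v) :
    wordF s' ∈ WleF w := by
  refine ⟨s', shortlexLE_of_not_lt fun h => ?_, rfl⟩
  have := (hsucc s' h).length_le
  simp at this

theorem clm_ext_of_orthogonal {ι H F : Type*} [NormedAddCommGroup H] [InnerProductSpace ℂ H]
    [CompleteSpace H] [NormedAddCommGroup F] [NormedSpace ℂ F] (a : ι → H) {S T : H →L[ℂ] F}
    (ha : ∀ i, S (a i) = T (a i))
    (horth : ∀ z : H, (∀ i, ⟪a i, z⟫ = 0) → S z = T z) : S = T := by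
  set K := (Submodule.span ℂ (Set.range a)).topologicalClosure
  have : CompleteSpace K := (Submodule.isClosed_topologicalClosure _).completeSpace_coe
  have hle : K ≤ (S - T).ker :=
    Submodule.topologicalClosure_minimal _
      (Submodule.span_le.2 (by rintro _ ⟨i, rfl⟩; simp [ha]))
      (S - T).isClosed_ker
  ext x
  obtain ⟨y, hy, z, hz, rfl⟩ := K.exists_add_mem_mem_orthogonal x
  have h1 : S y = T y := by simpa [sub_eq_zero] using hle hy
  have h2 : S z = T z := horth z fun i =>
    hz _ (Submodule.le_topologicalClosure _ (Submodule.subset_span ⟨i, rfl⟩))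
  simp [h1, h2]

/-- Two families with the same Gram matrix are related by a partial isometry `M`, whose initial
space is the closed span of the first family; `Q` is the projection onto the kernel of `M`. -/
theorem exists_partialIsometry {ι H : Type*} [NormedAddCommGroup H] [InnerProductSpace ℂ H]
    [CompleteSpace H] (a b : ι → H) (hab : ∀ i j, ⟪a i, a j⟫ = ⟪b i, b j⟫) :
    ∃ M Q : H →L[ℂ] H, (∀ i, M (a i) = b i) ∧ (∀ i, Q (a i) = 0) ∧
      (∀ x y, ⟪M x, M y⟫ + ⟪Q x, Q y⟫ = ⟪x, y⟫) ∧
      (∀ z : H, (∀ i, ⟪a i, z⟫ = 0) → M z = 0) := by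
  set K := (Submodule.span ℂ (Set.range a)).topologicalClosure with hK
  have : CompleteSpace K := (Submodule.isClosed_topologicalClosure _).completeSpace_coe
  have hmem (i) : a i ∈ K := Submodule.le_topologicalClosure _ (Submodule.subset_span ⟨i, rfl⟩)
  let e : (ι →₀ ℂ) →ₗ[ℂ] K := Finsupp.linearCombination ℂ fun i => (⟨a i, hmem i⟩ : K)
  let f : (ι →₀ ℂ) →ₗ[ℂ] H := Finsupp.linearCombination ℂ b
  have he (c) : (e c : H) = Finsupp.linearCombination ℂ a c := by
    simp [e, Finsupp.linearCombination_apply, Finsupp.sum]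
  have hnorm (c) : ‖f c‖ = ‖e c‖ := by
    have : ⟪f c, f c⟫ = ⟪(e c : H), (e c : H)⟫ := by
      rw [he]
      simp only [f, Finsupp.linearCombination_apply, Finsupp.sum, sum_inner, inner_sum,
        inner_smul_left, inner_smul_right, hab]
    rw [inner_self_eq_norm_sq_to_K, inner_self_eq_norm_sq_to_K] at this
    have h2 : ‖f c‖ ^ 2 = ‖(e c : H)‖ ^ 2 := by exact_mod_cast this
    exact (sq_eq_sq₀ (norm_nonneg _) (norm_nonneg _)).1 h2
  have hdense : DenseRange e := by
    intro x
    rw [closure_subtype]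
    refine closure_mono ?_ x.2
    intro y hy
    obtain ⟨c, rfl⟩ := (Finsupp.mem_span_range_iff_exists_finsupp).1 hy
    exact ⟨e c, ⟨c, rfl⟩, by rw [he]; rfl⟩
  let J : K →L[ℂ] H := f.extendOfNorm e
  have hJ (c) : J (e c) = f c :=
    LinearMap.extendOfNorm_eq hdense ⟨1, fun c => by simp [hnorm]⟩ c
  have hJnorm (x) : ‖J x‖ = ‖x‖ :=
    hdense.induction_on x (isClosed_eq (by fun_prop) (by fun_prop)) fun c => by rw [hJ, hnorm]
  let J' : K →ₗᵢ[ℂ] H := ⟨J.toLinearMap, hJnorm⟩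
  have hJJ (x y) : ⟪J x, J y⟫ = ⟪x, y⟫ := J'.inner_map_map x y
  have hself (i) : K.starProjection (a i) = a i :=
    Submodule.starProjection_eq_self_iff.2 (hmem i)
  refine ⟨J ∘L K.orthogonalProjectionOnto, ContinuousLinearMap.id ℂ H - K.starProjection,
    fun i => ?_, fun i => ?_, fun x y => ?_, fun z hz => ?_⟩
  · have h1 : K.orthogonalProjectionOnto (a i) = e (Finsupp.single i 1) := by
      ext
      rw [he, Finsupp.linearCombination_single, one_smul]
      exact hself i
    simp [h1, hJ, f]
  · simp [hself]
  · have h1 (x y : H) : ⟪x - K.starProjection x, K.starProjection y⟫ = 0 :=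
      K.starProjection_inner_eq_zero x _ (K.starProjection_apply_mem y)
    have h2 (x y : H) : ⟪K.starProjection y, x - K.starProjection x⟫ = 0 := by
      rw [← inner_conj_symm, h1, map_zero]
    have h3 : ⟪J (K.orthogonalProjectionOnto x), J (K.orthogonalProjectionOnto y)⟫ =
        ⟪K.starProjection x, K.starProjection y⟫ := hJJ _ _
    have h4 : ⟪x, y⟫ = ⟪K.starProjection x + (x - K.starProjection x),
        K.starProjection y + (y - K.starProjection y)⟫ := by simp
    rw [h4, inner_add_left, inner_add_right, inner_add_right, h1, h2]
    simp only [ContinuousLinearMap.comp_apply, h3, sub_apply, ContinuousLinearMap.id_apply]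
    ring
  · have hz' : z ∈ Kᗮ := by
      rw [hK, Submodule.orthogonal_closure, Submodule.mem_orthogonal]
      intro u hu
      induction hu using Submodule.span_induction with
      | mem x hx => obtain ⟨i, rfl⟩ := hx; exact hz i
      | zero => simp
      | add x y _ _ hx hy => rw [inner_add_left, hx, hy, add_zero]
      | smul c x _ hx => rw [inner_smul_left, hx, mul_zero]
    simp [Submodule.orthogonalProjectionOnto_eq_zero_iff.2 hz']

theorem finsum_form_eq_sum {g : ℕ} {G : Type*} [Group G] {E : Type*}
    [NormedAddCommGroup E] [InnerProductSpace ℂ E] {T : Set (FreeGroup (Fin g))} (hT : T.Finite)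
    (χ : FreeGroup (Fin g) → G → (E →L[ℂ] E)) (f : FreeGroup (Fin g) → G →₀ E) :
    ∑ᶠ u ∈ T, ∑ᶠ v ∈ T, ∑ᶠ g₁ : G, ∑ᶠ h₁ : G,
      ⟪f u g₁, χ (u⁻¹ * v) (g₁⁻¹ * h₁) (f v h₁)⟫ =
    ∑ u ∈ hT.toFinset, ∑ v ∈ hT.toFinset, (f u).sum fun g₁ a => (f v).sum fun h₁ b =>
      ⟪a, χ (u⁻¹ * v) (g₁⁻¹ * h₁) b⟫ := by
  simp only [finsum_mem_eq_finite_toFinset_sum _ hT]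
  refine Finset.sum_congr rfl fun u _ => Finset.sum_congr rfl fun v _ => ?_
  have h1 (g₁ : G) : ∑ᶠ h₁ : G, ⟪f u g₁, χ (u⁻¹ * v) (g₁⁻¹ * h₁) (f v h₁)⟫ =
      (f v).sum fun h₁ b => ⟪f u g₁, χ (u⁻¹ * v) (g₁⁻¹ * h₁) b⟫ := by
    refine finsum_eq_sum_of_support_subset _ fun h hh => ?_
    contrapose! hh
    simp at hh
    simp [hh]
  simp only [h1]
  refine finsum_eq_sum_of_support_subset _ fun h hh => ?_
  contrapose! hh
  simp at hh
  simp [hh]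

theorem formPSD_of_inner_eq {g : ℕ} {G : Type*} [Group G] {E H : Type*}
    [NormedAddCommGroup E] [InnerProductSpace ℂ E] [NormedAddCommGroup H] [InnerProductSpace ℂ H]
    {T : Set (FreeGroup (Fin g))} (hT : T.Finite) {χ : FreeGroup (Fin g) → G → (E →L[ℂ] E)}
    (V : FreeGroup (Fin g) → G → E → H)
    (hV : ∀ u ∈ T, ∀ v ∈ T, ∀ (g₁ h₁ : G) (a b : E),
      ⟪V u g₁ a, V v h₁ b⟫ = ⟪a, χ (u⁻¹ * v) (g₁⁻¹ * h₁) b⟫) : FormPSD T χ := by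
  intro f
  set z : H := ∑ u ∈ hT.toFinset, (f u).sum fun g₁ a => V u g₁ a with hz
  have key : ∑ᶠ u ∈ T, ∑ᶠ v ∈ T, ∑ᶠ g₁ : G, ∑ᶠ h₁ : G,
      ⟪f u g₁, χ (u⁻¹ * v) (g₁⁻¹ * h₁) (f v h₁)⟫ = ⟪z, z⟫ := by
    rw [finsum_form_eq_sum hT, hz]
    simp only [Finsupp.sum, sum_inner]
    simp only [inner_sum]
    refine Finset.sum_congr rfl fun u hu => ?_
    rw [Finset.sum_comm]
    refine Finset.sum_congr rfl fun g₁ _ => Finset.sum_congr rfl fun v hv =>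
      Finset.sum_congr rfl fun h₁ _ => ?_
    rw [hV u (by simpa using hu) v (by simpa using hv)]
  rw [key]
  exact ⟨inner_self_nonneg (𝕜 := ℂ), inner_self_im (𝕜 := ℂ) z⟩

theorem finsupp_sum_eq_sum_curry {α β M N : Type*} [AddCommMonoid M] [AddCommMonoid N]
    {T : Finset α} (f : α × β →₀ M) (φ : α × β → M → N) (hφ : ∀ x ∉ T, ∀ y a, φ (x, y) a = 0) :
    f.sum φ = ∑ x ∈ T, (f.curry x).sum fun y a => φ (x, y) a := by
  have := Finsupp.sum_curry_index f fun x y a => φ (x, y) a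
  simp only [Prod.mk.eta] at this
  rw [← this]
  refine Finset.sum_congr_of_eq_on_inter ?_ ?_ ?_
  · intro x _ hx
    simp [hφ x hx]
  · intro x _ hx
    rw [Finsupp.notMem_support_iff.1 hx, Finsupp.sum_zero_index]
  · intros; rfl

/-- The matrix over `F_g × G` determined by a form, extended by zero outside `T`. -/
noncomputable def formMatrix {g : ℕ} {G : Type*} [Group G] {E : Type*}
    [NormedAddCommGroup E] [InnerProductSpace ℂ E]
    (T : Set (FreeGroup (Fin g))) (χ : FreeGroup (Fin g) → G → (E →L[ℂ] E)) :
    Matrix (FreeGroup (Fin g) × G) (FreeGroup (Fin g) × G) (E →L[ℂ] E) :=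
  open Classical in fun x y =>
    if x.1 ∈ T ∧ y.1 ∈ T then χ (x.1⁻¹ * y.1) (x.2⁻¹ * y.2) else 0

theorem FormPSD.formMatrix_sum {g : ℕ} {G : Type*} [Group G] {E : Type*}
    [NormedAddCommGroup E] [InnerProductSpace ℂ E]
    {T : Set (FreeGroup (Fin g))} (hT : T.Finite) {χ : FreeGroup (Fin g) → G → (E →L[ℂ] E)}
    (hχ : FormPSD T χ) (f : FreeGroup (Fin g) × G →₀ E) :
    0 ≤ (f.sum fun x a => f.sum fun y b => ⟪a, formMatrix T χ x y b⟫).re ∧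
      (f.sum fun x a => f.sum fun y b => ⟪a, formMatrix T χ x y b⟫).im = 0 := by
  have h := hχ fun u => f.curry u
  rw [finsum_form_eq_sum hT] at h
  convert h using 3 <;>
  · rw [finsupp_sum_eq_sum_curry (T := hT.toFinset)]
    · refine Finset.sum_congr rfl fun u hu => ?_
      rw [Finsupp.sum, Finset.sum_congr rfl fun g₁ _ =>
        finsupp_sum_eq_sum_curry (T := hT.toFinset) f _ ?_, Finset.sum_comm]
      · refine Finset.sum_congr rfl fun v hv => ?_
        simp only [Set.Finite.mem_toFinset] at hu hv
        simp [Finsupp.sum, formMatrix, hu, hv]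
      · intro v hv h₁ b
        simp only [Set.Finite.mem_toFinset] at hv
        simp [formMatrix, hv]
    · intro u hu g₁ a
      simp only [Set.Finite.mem_toFinset] at hu
      simp [formMatrix, hu]

theorem posSemidef_of_sum_nonneg {X E : Type*} [NormedAddCommGroup E] [InnerProductSpace ℂ E]
    [CompleteSpace E] (K : Matrix X X (E →L[ℂ] E))
    (hK : ∀ f : X →₀ E, 0 ≤ (f.sum fun x a => f.sum fun y b => ⟪a, K x y b⟫).re ∧
      (f.sum fun x a => f.sum fun y b => ⟪a, K x y b⟫).im = 0) : K.PosSemidef := by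
  have hdiag (x a) : (⟪a, K x x a⟫).im = 0 := by
    simpa using (hK (Finsupp.single x a)).2
  have hsum (x y a b) : (⟪a, K x y b⟫ + ⟪b, K y x a⟫).im = 0 := by
    have h := (hK (Finsupp.single x a + Finsupp.single y b)).2
    have sum_pair (φ : X → E → ℂ) (h0 : ∀ x, φ x 0 = 0) (hφ : ∀ x a b, φ x (a + b) = φ x a + φ x b) :
        (Finsupp.single x a + Finsupp.single y b).sum φ = φ x a + φ y b := by
      rw [Finsupp.sum_add_index' h0 hφ, Finsupp.sum_single_index (h0 _),
        Finsupp.sum_single_index (h0 _)]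
    have sum_inner_pair (c : E) (z : X) : ((Finsupp.single x a + Finsupp.single y b).sum fun y b =>
        ⟪c, K z y b⟫) = ⟪c, K z x a⟫ + ⟪c, K z y b⟫ :=
      sum_pair (fun y b => ⟪c, K z y b⟫) (by simp) (by simp)
    simp only [sum_inner_pair] at h
    rw [sum_pair _ (by simp) (by intros; simp only [inner_add_left]; ring)] at h
    have h1 := hdiag x a
    have h2 := hdiag y b
    simp only [Complex.add_im] at h ⊢
    linarith
  have hsymm (x y a b) : ⟪K y x a, b⟫ = ⟪a, K x y b⟫ := by
    have h1 := hsum x y a b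
    have h2 := hsum x y a (Complex.I • b)
    rw [← inner_conj_symm (K y x a) b]
    simp at h1 h2
    apply Complex.ext
    · rw [Complex.conj_re]
      linarith
    · rw [Complex.conj_im]
      linarith
  refine (RKHS.posSemidef_tfae.out 0 2 :
    K.PosSemidef ↔ K.IsHermitian ∧ ∀ f : X →₀ E,
      0 ≤ RCLike.re (f.sum fun x a => f.sum fun y b => ⟪K y x a, b⟫)).2 ⟨?_, fun f => ?_⟩
  · ext x y a
    refine ext_inner_left ℂ fun b => ?_
    rw [Matrix.conjTranspose_apply, ContinuousLinearMap.star_eq_adjoint,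
      ContinuousLinearMap.adjoint_inner_right, hsymm]
  · simp only [hsymm]
    exact (hK f).1

/-- Kolmogorov decomposition of a positive semidefinite form on a finite index set. -/
theorem FormPSD.exists_kolmogorov {g : ℕ} {G : Type} [Group G] {E : Type}
    [NormedAddCommGroup E] [InnerProductSpace ℂ E] [CompleteSpace E]
    {T : Set (FreeGroup (Fin g))} (hT : T.Finite) {χ : FreeGroup (Fin g) → G → (E →L[ℂ] E)}
    (hχ : FormPSD T χ) :
    ∃ (H : Type) (_ : NormedAddCommGroup H) (_ : InnerProductSpace ℂ H) (_ : CompleteSpace H)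
      (V : FreeGroup (Fin g) → G → (E →L[ℂ] H)),
      ∀ u ∈ T, ∀ v ∈ T, ∀ (g₁ h₁ : G) (a b : E),
        ⟪V u g₁ a, V v h₁ b⟫ = ⟪a, χ (u⁻¹ * v) (g₁⁻¹ * h₁) b⟫ := by
  have : Fact (formMatrix T χ).PosSemidef :=
    ⟨posSemidef_of_sum_nonneg _ (hχ.formMatrix_sum hT)⟩
  refine ⟨RKHS.OfKernel (formMatrix T χ), inferInstance, inferInstance, inferInstance,
    fun u g₁ => RKHS.kerFun _ (u, g₁), fun u hu v hv g₁ h₁ a b => ?_⟩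
  rw [← ContinuousLinearMap.adjoint_inner_right, ← ContinuousLinearMap.comp_apply,
    ← RKHS.kernel_apply, RKHS.OfKernel.kernel_ofKernel]
  simp [formMatrix, hu, hv]

/-- Given vectors `V u g₁ a`, `u ∈ W`, realizing a form `χ`, the vectors `Y h₁ b` prescribe
consistent inner products for a new index `x * t`. -/
theorem exists_completion_vectors {F G E H : Type*} [Group F] [Group G]
    [NormedAddCommGroup E] [InnerProductSpace ℂ E] [CompleteSpace E]
    [NormedAddCommGroup H] [InnerProductSpace ℂ H] [CompleteSpace H]
    {W : Set F} {χ : F → G → (E →L[ℂ] E)} {V : F → G → (E →L[ℂ] H)}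
    (hV : ∀ u ∈ W, ∀ v ∈ W, ∀ (g₁ h₁ : G) (a b : E),
      ⟪V u g₁ a, V v h₁ b⟫ = ⟪a, χ (u⁻¹ * v) (g₁⁻¹ * h₁) b⟫) (x : F) {t : F} (ht : t ∈ W) :
    ∃ (c : F → G → (E →L[ℂ] E)) (Y Z : G → E → H),
      (∀ g₁ h₁ a b, ⟪Y g₁ a, Y h₁ b⟫ + ⟪Z g₁ a, Z h₁ b⟫ = ⟪a, χ 1 (g₁⁻¹ * h₁) b⟫) ∧
      (∀ u ∈ W, ∀ g₁ h₁ a b, ⟪V u g₁ a, Y h₁ b⟫ = ⟪a, c u (g₁⁻¹ * h₁) b⟫) ∧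
      (∀ v ∈ W, x * v ∈ W → ∀ g₁ h₁ a b,
        ⟪V (x * v) g₁ a, Y h₁ b⟫ = ⟪a, χ (v⁻¹ * t) (g₁⁻¹ * h₁) b⟫) := by
  obtain ⟨M, Q, hM, hQ, hMQ, hM0⟩ := exists_partialIsometry
    (fun i : {v // v ∈ W ∧ x * v ∈ W} × G × E => V i.1 i.2.1 i.2.2)
    (fun i => V (x * i.1) i.2.1 i.2.2) (by
      rintro ⟨⟨u, hu, hxu⟩, g₁, a⟩ ⟨⟨v, hv, hxv⟩, h₁, b⟩
      simp only [hV u hu v hv, hV _ hxu _ hxv]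
      rw [show (x * u)⁻¹ * (x * v) = u⁻¹ * v by group])
  have translate (k : G) : ∃ U : H →L[ℂ] H, (∀ u ∈ W, ∀ g₁ a, U (V u g₁ a) = V u (k * g₁) a) ∧
      (∀ u ∈ W, ∀ g₁ a z, ⟪V u (k * g₁) a, U z⟫ = ⟪V u g₁ a, z⟫) := by
    obtain ⟨U, R, hU, hR, hUR, -⟩ := exists_partialIsometry
      (fun i : W × G × E => V i.1 i.2.1 i.2.2) (fun i => V i.1 (k * i.2.1) i.2.2) (by
        rintro ⟨⟨u, hu⟩, g₁, a⟩ ⟨⟨v, hv⟩, h₁, b⟩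
        simp only [hV u hu v hv]
        rw [show (k * g₁)⁻¹ * (k * h₁) = g₁⁻¹ * h₁ by group])
    refine ⟨U, fun u hu g₁ a => hU (⟨u, hu⟩, g₁, a), fun u hu g₁ a z => ?_⟩
    have h1 := hU (⟨u, hu⟩, g₁, a)
    have h2 := hR (⟨u, hu⟩, g₁, a)
    simp only at h1 h2
    rw [← hUR (V u g₁ a) z, h1, h2, inner_zero_left, add_zero]
  have inv (k : G) (u) (hu : u ∈ W) (g₁ h₁ a b) :
      ⟪V u (k * g₁) a, M (V t (k * h₁) b)⟫ = ⟪V u g₁ a, M (V t h₁ b)⟫ := by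
    obtain ⟨U, hU, hUi⟩ := translate k
    have comm : M ∘L U = U ∘L M := by
      refine clm_ext_of_orthogonal
        (fun i : {v // v ∈ W ∧ x * v ∈ W} × G × E => V i.1 i.2.1 i.2.2) ?_ fun z hz => ?_
      · rintro ⟨⟨v, hv, hxv⟩, h₁, b⟩
        have h1 := hM (⟨v, hv, hxv⟩, h₁, b)
        have h2 := hM (⟨v, hv, hxv⟩, k * h₁, b)
        simp only [ContinuousLinearMap.comp_apply, hU v hv] at h1 h2 ⊢
        rw [h1, h2, hU _ hxv]
      · rw [ContinuousLinearMap.comp_apply, ContinuousLinearMap.comp_apply, hM0 z hz, map_zero]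
        refine hM0 _ ?_
        rintro ⟨⟨v, hv, hxv⟩, h₁, b⟩
        have := hUi v hv (k⁻¹ * h₁) b z
        rw [mul_inv_cancel_left] at this
        exact this.trans (hz (⟨v, hv, hxv⟩, k⁻¹ * h₁, b))
    rw [← hU t ht, ← ContinuousLinearMap.comp_apply, comm, ContinuousLinearMap.comp_apply,
      hUi u hu]
  refine ⟨fun u k => (V u 1).adjoint ∘L M ∘L V t k, fun h₁ b => M (V t h₁ b),
    fun h₁ b => Q (V t h₁ b), fun g₁ h₁ a b => ?_, fun u hu g₁ h₁ a b => ?_,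
    fun v hv hxv g₁ h₁ a b => ?_⟩
  · rw [hMQ, hV t ht t ht, inv_mul_cancel]
  · rw [ContinuousLinearMap.comp_apply, ContinuousLinearMap.adjoint_inner_right,
      ContinuousLinearMap.comp_apply, ← inv g₁⁻¹ u hu, inv_mul_cancel]
  · have h1 := hM (⟨v, hv, hxv⟩, g₁, a)
    have h2 := hQ (⟨v, hv, hxv⟩, g₁, a)
    simp only at h1 h2
    rw [← hV v hv t ht, ← hMQ (V v g₁ a), h1, h2, inner_zero_left, add_zero]

/-- Matrix completion for the free semigroup: a psd `w`-partially defined form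
extends to a psd `s`-partially defined form, `s` the shortlex successor of `w`. -/
theorem stmt12
    (G : Type) [Group G]
    (E : Type) [NormedAddCommGroup E] [InnerProductSpace ℂ E] [CompleteSpace E]
    (g : ℕ) (hg : 0 < g)
    (w s : List (Fin g))
    (hlt : ShortlexLT w s)
    (hsucc : ∀ v : List (Fin g), ShortlexLT w v → ShortlexLE s v)
    (χ : FreeGroup (Fin g) → G → (E →L[ℂ] E))
    (hχ : FormPSD (WleF w) χ) :
    ∃ χ' : FreeGroup (Fin g) → G → (E →L[ℂ] E),
      (∀ α ∈ HerWleF w, χ' α = χ α) ∧ FormPSD (WleF s) χ' := by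
  classical
  obtain _ | ⟨x, t⟩ := s
  · rcases hlt with h | ⟨-, h⟩
    · simp at h
    · cases h
  have ht := wordF_tail_mem_WleF hsucc
  have hS : wordF (x :: t) = FreeGroup.of x * wordF t := rfl
  have hSW : wordF (x :: t) ∉ WleF w := wordF_notMem_WleF hlt
  obtain ⟨H, _, _, _, V, hV⟩ := hχ.exists_kolmogorov (finite_WleF w)
  obtain ⟨c, Y, Z, hYZ, hc, hxY⟩ := exists_completion_vectors hV (FreeGroup.of x) ht
  have hsplit {u p q : FreeGroup (Fin g)} (hu : u ∈ WleF w) (hp : ∃ l, wordF l = p)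
      (hq : q ∈ WleF w) (h : p⁻¹ * q = u⁻¹ * wordF (x :: t)) :
      ∃ v ∈ WleF w, u = FreeGroup.of x * v := exists_eq_of_mul_of_inv_mul_eq hlt hu hq hp h
  have hsub : WleF (x :: t) ⊆ insert (wordF (x :: t)) (WleF w) := WleF_subset_insert hsucc
  generalize hSdef : wordF (x :: t) = S at hS hSW hsplit hsub
  let χ' : FreeGroup (Fin g) → G → (E →L[ℂ] E) := fun α =>
    if α ∈ HerWleF w then χ α
    else if S * α⁻¹ ∈ WleF w then c (S * α⁻¹)
    else fun k => (c (S * α) k⁻¹).adjoint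
  have hχ' (α) (hα : α ∈ HerWleF w) : χ' α = χ α := if_pos hα
  have hright (u) (hu : u ∈ WleF w) (g₁ h₁ a b) :
      ⟪V u g₁ a, Y h₁ b⟫ = ⟪a, χ' (u⁻¹ * S) (g₁⁻¹ * h₁) b⟫ := by
    by_cases hα : u⁻¹ * S ∈ HerWleF w
    · obtain ⟨p, ⟨l, -, hl⟩, q, hq, hpq⟩ := id hα
      obtain ⟨v, hv, rfl⟩ := hsplit hu ⟨l, hl⟩ hq hpq
      rw [hχ' _ hα, hxY v hv hu,
        show (FreeGroup.of x * v)⁻¹ * S = v⁻¹ * wordF t by rw [hS]; group]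
    · have : S * (u⁻¹ * S)⁻¹ = u := by group
      rw [hc u hu]
      simp only [χ', if_neg hα, this, if_pos hu]
  have hleft (v) (hv : v ∈ WleF w) (g₁ h₁ a b) :
      ⟪Y g₁ a, V v h₁ b⟫ = ⟪a, χ' (S⁻¹ * v) (g₁⁻¹ * h₁) b⟫ := by
    have hof : (∃ v' ∈ WleF w, v = FreeGroup.of x * v') →
        ⟪Y g₁ a, V v h₁ b⟫ = ⟪a, χ' (S⁻¹ * v) (g₁⁻¹ * h₁) b⟫ := by
      rintro ⟨v', hv', rfl⟩
      have h1 : S⁻¹ * (FreeGroup.of x * v') = (wordF t)⁻¹ * v' := by rw [hS]; group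
      have hα : S⁻¹ * (FreeGroup.of x * v') ∈ HerWleF w := ⟨_, ht, v', hv', h1.symm⟩
      rw [hχ' _ hα, h1, ← inner_conj_symm, hxY v' hv' hv, ← hV v' hv' _ ht, inner_conj_symm,
        hV _ ht v' hv']
    by_cases hα : S⁻¹ * v ∈ HerWleF w
    · obtain ⟨p, ⟨l, hl, hlp⟩, q, ⟨m, -, hm⟩, hpq⟩ := hα
      refine hof (hsplit (p := q) (q := p) hv ⟨m, hm⟩ ⟨l, hl, hlp⟩ ?_)
      simpa using congrArg (·⁻¹) hpq
    · by_cases h2 : S * (S⁻¹ * v)⁻¹ ∈ WleF w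
      · refine hof (hsplit (p := S) hv ⟨_, hSdef⟩ h2 ?_)
        group
      · have : S * (S⁻¹ * v) = v := by group
        simp only [χ', if_neg hα, if_neg h2, this]
        rw [ContinuousLinearMap.adjoint_inner_right, ← inner_conj_symm, hc v hv, mul_inv_rev,
          inv_inv, inner_conj_symm]
  refine ⟨χ', hχ', ?_⟩
  have h1 : (1 : FreeGroup (Fin g)) ∈ HerWleF w := ⟨_, ht, _, ht, inv_mul_cancel _⟩
  refine formPSD_of_inner_eq (H := WithLp 2 (H × H)) (finite_WleF _)
    (fun u k a => if u = S then WithLp.toLp 2 (Y k a, Z k a) else WithLp.toLp 2 (V u k a, 0))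
    fun u hu v hv g₁ h₁ a b => ?_
  have hne {u} (hu : u ∈ WleF w) : u ≠ S := fun h => hSW (h ▸ hu)
  rcases hsub hu with rfl | hu <;> rcases hsub hv with rfl | hv
  · simp [WithLp.prod_inner_apply, hYZ, hχ' 1 h1]
  · simp [WithLp.prod_inner_apply, hne hv, hleft v hv]
  · simp [WithLp.prod_inner_apply, hne hu, hright u hu]
  · simp [WithLp.prod_inner_apply, hne hu, hne hv, hV u hu v hv, hχ' _ ⟨u, hu, v, hv, rfl⟩]
end

section
/- Let G be a group, E a complex Hilbert space, and g a positive integer. If p : Her⟨x⟩_g × G → B(E) is positive semidefinite, then there exist a complex Hilbert space F, a unitary representation π of the direct product group F_g × G on F, and a bounded linear operator W : E → F such that p(u⁻¹v, γ⁻¹δ) = W* π(u⁻¹v, γ⁻¹δ) W for all u, v ∈ ⟨x⟩_g and all γ, δ ∈ G. Moreover, if p evaluated at the identity of F_g × G equals the identity operator on E, then W can be chosen to be an isometry. -/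
open scoped ComplexInnerProductSpace

/-- A bundled complex Hilbert space. -/
structure HilbertC : Type 1 where
  carrier : Type
  [nacg : NormedAddCommGroup carrier]
  [ips : InnerProductSpace ℂ carrier]
  [complete : CompleteSpace carrier]

attribute [instance] HilbertC.nacg HilbertC.ips HilbertC.complete

/-- `p : Her⟨x⟩_g × G → B(E)` is positive semidefinite: for every finitely
supported `e : ⟨x⟩_g × G → E`, the associated form is real and nonnegative. -/
def IsPSDkernel {g : ℕ} {G : Type*} [Group G] {E : Type*}
    [NormedAddCommGroup E] [InnerProductSpace ℂ E]
    (p : FreeGroup (Fin g) × G → (E →L[ℂ] E)) : Prop :=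
  ∀ e : (List (Fin g) × G) →₀ E,
    0 ≤ (∑ᶠ x : List (Fin g) × G, ∑ᶠ y : List (Fin g) × G,
          ⟪e x, p ((wordF x.1)⁻¹ * wordF y.1, x.2⁻¹ * y.2) (e y)⟫).re ∧
    (∑ᶠ x : List (Fin g) × G, ∑ᶠ y : List (Fin g) × G,
          ⟪e x, p ((wordF x.1)⁻¹ * wordF y.1, x.2⁻¹ * y.2) (e y)⟫).im = 0

open RKHS ContinuousLinearMap

section Isometry

variable {ι H H' : Type*} [NormedAddCommGroup H] [InnerProductSpace ℂ H]
  [NormedAddCommGroup H'] [InnerProductSpace ℂ H'] [CompleteSpace H']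

/-- A family with the same Gram matrix as a total family is its image under a linear isometry. -/
lemma exists_linearIsometry_of_inner_eq (a : ι → H) (b : ι → H')
    (ha : (Submodule.span ℂ (Set.range a)).topologicalClosure = ⊤)
    (hab : ∀ i j, ⟪b i, b j⟫ = ⟪a i, a j⟫) :
    ∃ T : H →L[ℂ] H', (∀ x, ‖T x‖ = ‖x‖) ∧ ∀ i, T (a i) = b i := by
  set A := Finsupp.linearCombination ℂ a with hA
  set B := Finsupp.linearCombination ℂ b with hB
  have hnorm : ∀ f, ‖B f‖ = ‖A f‖ := by
    intro f
    have : ⟪B f, B f⟫ = ⟪A f, A f⟫ := by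
      simp only [hA, hB, Finsupp.linearCombination_apply, Finsupp.sum_inner, Finsupp.inner_sum,
        inner_smul_left, inner_smul_right, hab]
    rw [@norm_eq_sqrt_re_inner ℂ, @norm_eq_sqrt_re_inner ℂ, this]
  have hdense : DenseRange A := by
    have : (LinearMap.range A).topologicalClosure = ⊤ := by
      rw [hA, Finsupp.range_linearCombination, ha]
    exact Submodule.dense_iff_topologicalClosure_eq_top.mpr this
  have hT : ∀ f, B.extendOfNorm A (A f) = B f :=
    LinearMap.extendOfNorm_eq hdense ⟨1, fun f ↦ by rw [hnorm, one_mul]⟩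
  refine ⟨B.extendOfNorm A, fun x ↦ ?_, fun i ↦ ?_⟩
  · refine hdense.induction_on (p := fun x ↦ ‖B.extendOfNorm A x‖ = ‖x‖) x
      (isClosed_eq (by fun_prop) (by fun_prop)) fun f ↦ ?_
    rw [hT, hnorm]
  · simpa [hA, hB] using hT (Finsupp.single i 1)

lemma star_mul_self_eq_one_of_norm_map [CompleteSpace H] {T : H →L[ℂ] H} (hT : ∀ x, ‖T x‖ = ‖x‖) :
    star T * T = 1 :=
  (ContinuousLinearMap.norm_map_iff_adjoint_comp_self T).mp hT

end Isometry

section BlockOperator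

variable {H : Type*} [NormedAddCommGroup H] [InnerProductSpace ℂ H]

/-- The operator on `H ⊕ H` given by a two-by-two matrix of operators on `H`. -/
noncomputable def blockOp (A B C D : H →L[ℂ] H) : WithLp 2 (H × H) →L[ℂ] WithLp 2 (H × H) :=
  ((WithLp.prodContinuousLinearEquiv 2 ℂ H H).symm : H × H →L[ℂ] WithLp 2 (H × H)) ∘L
    ((A.coprod B).prod (C.coprod D)) ∘L
      (WithLp.prodContinuousLinearEquiv 2 ℂ H H : WithLp 2 (H × H) →L[ℂ] H × H)

lemma blockOp_apply (A B C D : H →L[ℂ] H) (x : WithLp 2 (H × H)) :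
    blockOp A B C D x = WithLp.toLp 2 (A x.fst + B x.snd, C x.fst + D x.snd) := rfl

lemma blockOp_one : blockOp 1 0 0 1 = (1 : WithLp 2 (H × H) →L[ℂ] WithLp 2 (H × H)) := by
  ext x
  simp [blockOp_apply]
  rfl

lemma blockOp_mul (A B C D A' B' C' D' : H →L[ℂ] H) :
    blockOp A B C D * blockOp A' B' C' D' =
      blockOp (A * A' + B * C') (A * B' + B * D') (C * A' + D * C') (C * B' + D * D') := by
  ext x
  simp [blockOp_apply]
  constructor <;> abel

lemma star_blockOp [CompleteSpace H] (A B C D : H →L[ℂ] H) :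
    star (blockOp A B C D) = blockOp (star A) (star C) (star B) (star D) := by
  refine ((ContinuousLinearMap.eq_adjoint_iff _ _).mpr fun x y ↦ ?_).symm
  simp only [blockOp_apply, WithLp.prod_inner_apply, inner_add_left, inner_add_right,
    ContinuousLinearMap.star_eq_adjoint, ContinuousLinearMap.adjoint_inner_left]
  exact add_add_add_comm _ _ _ _

variable [CompleteSpace H]

/-- The Julia operator of an isometry, a unitary dilation of it to `H ⊕ H`. -/
noncomputable def juliaOp (S : H →L[ℂ] H) (hS : star S * S = 1) :
    unitary (WithLp 2 (H × H) →L[ℂ] WithLp 2 (H × H)) :=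
  ⟨blockOp S (1 - S * star S) 0 (star S), by
    have h₁ : star S * (1 - S * star S) = 0 := by
      rw [mul_sub, mul_one, ← mul_assoc, hS, one_mul, sub_self]
    have h₂ : (1 - S * star S) * S = 0 := by
      rw [sub_mul, one_mul, mul_assoc, hS, mul_one, sub_self]
    have h₃ : (1 - S * star S) * (1 - S * star S) = 1 - S * star S := by
      rw [sub_mul, one_mul, mul_assoc, h₁, mul_zero, sub_zero]
    have h₄ : star (1 - S * star S) = 1 - S * star S := by simp
    rw [Unitary.mem_iff, star_blockOp, blockOp_mul, blockOp_mul, h₄, star_star, h₁, h₂, h₃]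
    simp [hS, blockOp_one]⟩

/-- The diagonal action of a group of unitaries on `H ⊕ H`. -/
noncomputable def diagUnitary {G : Type*} [Group G] (U : G →* unitary (H →L[ℂ] H)) :
    G →* unitary (WithLp 2 (H × H) →L[ℂ] WithLp 2 (H × H)) where
  toFun γ := ⟨blockOp (U γ) 0 0 (U γ), by
    rw [Unitary.mem_iff, star_blockOp, blockOp_mul, blockOp_mul]
    simp [blockOp_one]⟩
  map_one' := Subtype.ext <| by simp [blockOp_one]
  map_mul' γ δ := Subtype.ext <| by simp [blockOp_mul]

lemma commute_juliaOp_diagUnitary {G : Type*} [Group G] (U : G →* unitary (H →L[ℂ] H))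
    (S : H →L[ℂ] H) (hS : star S * S = 1) (γ : G)
    (h : ∀ γ, S * (U γ : H →L[ℂ] H) = U γ * S) :
    Commute (juliaOp S hS) (diagUnitary U γ) := by
  have h' : star S * (U γ : H →L[ℂ] H) = U γ * star S := by
    have := congrArg star (h γ⁻¹)
    simpa [← Unitary.star_eq_inv] using this.symm
  refine Subtype.ext ?_
  change blockOp _ _ _ _ * blockOp _ _ _ _ = blockOp _ _ _ _ * blockOp _ _ _ _
  have h'' : S * star S * (U γ : H →L[ℂ] H) = U γ * (S * star S) := by
    rw [mul_assoc, h', ← mul_assoc, h, mul_assoc]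
  rw [blockOp_mul, blockOp_mul]
  simp [sub_mul, mul_sub, h, h', h'']

/-- Isometries commuting with a group of unitaries extend to unitaries on `H ⊕ H` commuting with
the diagonal action of that group. -/
lemma exists_unitary_extension {ι G : Type*} [Group G] (U : G →* unitary (H →L[ℂ] H))
    (S : ι → H →L[ℂ] H) (hS : ∀ i, star (S i) * S i = 1)
    (hSU : ∀ i γ, S i * (U γ : H →L[ℂ] H) = U γ * S i) :
    ∃ ρ : FreeGroup ι × G →* unitary (WithLp 2 (H × H) →L[ℂ] WithLp 2 (H × H)),
      (∀ i h, (ρ (FreeGroup.of i, 1) : WithLp 2 (H × H) →L[ℂ] WithLp 2 (H × H))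
        (WithLp.toLp 2 (h, 0)) = WithLp.toLp 2 (S i h, 0)) ∧
      ∀ γ h, (ρ (1, γ) : WithLp 2 (H × H) →L[ℂ] WithLp 2 (H × H))
        (WithLp.toLp 2 (h, 0)) = WithLp.toLp 2 ((U γ : H →L[ℂ] H) h, 0) := by
  let Φ := FreeGroup.lift fun i ↦ juliaOp (S i) (hS i)
  have hcomm (w : FreeGroup ι) (γ : G) : Commute (Φ w) (diagUnitary U γ) := by
    induction w using FreeGroup.induction_on with
    | C1 => rw [map_one]; exact Commute.one_left _
    | of i =>
      simp only [Φ, FreeGroup.lift_apply_of]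
      exact commute_juliaOp_diagUnitary U (S i) (hS i) γ (hSU i)
    | inv_of i h => rw [map_inv]; exact h.inv_left
    | mul a b ha hb => rw [map_mul]; exact ha.mul_left hb
  refine ⟨Φ.noncommCoprod (diagUnitary U) hcomm, fun i h ↦ ?_, fun γ h ↦ ?_⟩
  · rw [MonoidHom.noncommCoprod_apply, map_one, mul_one]
    simp [Φ, juliaOp, blockOp_apply]
  · rw [MonoidHom.noncommCoprod_apply, map_one, one_mul]
    simp [diagUnitary, blockOp_apply]

end BlockOperator

/-- The kernel on `⟨x⟩_g × G` associated with a function on `F_g × G`. -/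
def hereditaryKernel {g : ℕ} {G : Type*} [Group G] {E : Type*}
    [NormedAddCommGroup E] [InnerProductSpace ℂ E]
    (p : FreeGroup (Fin g) × G → (E →L[ℂ] E)) :
    Matrix (List (Fin g) × G) (List (Fin g) × G) (E →L[ℂ] E) :=
  .of fun x y ↦ p ((wordF x.1)⁻¹ * wordF y.1, x.2⁻¹ * y.2)

section Kernel

variable {X E : Type*} [NormedAddCommGroup E] [InnerProductSpace ℂ E]

lemma finsum_finsum_inner_eq (K : Matrix X X (E →L[ℂ] E)) (e : X →₀ E) :
    ∑ᶠ x, ∑ᶠ y, ⟪e x, K x y (e y)⟫ = e.sum fun x a ↦ e.sum fun y b ↦ ⟪a, K x y b⟫ := by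
  have hy (x : X) : ∑ᶠ y, ⟪e x, K x y (e y)⟫ = e.sum fun y b ↦ ⟪e x, K x y b⟫ :=
    finsum_eq_sum_of_support_subset _ fun y hy ↦ by
      by_contra h
      simp_all
  simp only [hy]
  refine finsum_eq_sum_of_support_subset _ fun x hx ↦ ?_
  by_contra h
  simp_all

lemma sum_single_add_single (K : Matrix X X (E →L[ℂ] E)) (x y : X) (a b : E) :
    ((Finsupp.single x a + Finsupp.single y b).sum fun x' a' ↦
      (Finsupp.single x a + Finsupp.single y b).sum fun y' b' ↦ ⟪a', K x' y' b'⟫) =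
    ⟪a, K x x a⟫ + ⟪a, K x y b⟫ + (⟪b, K y x a⟫ + ⟪b, K y y b⟫) := by
  classical
  have (f : X →₀ E) (x' : X) (a' : E) :
      ((f + Finsupp.single y b).sum fun y' b' ↦ ⟪a', K x' y' b'⟫) =
        (f.sum fun y' b' ↦ ⟪a', K x' y' b'⟫) + ⟪a', K x' y b⟫ := by
    rw [Finsupp.sum_add_index'] <;> simp
  simp only [this]
  rw [Finsupp.sum_add_index'] <;> simp
  intro x' a₁ a₂
  ring

lemma posSemidef_of_finsum_nonneg [CompleteSpace E] (K : Matrix X X (E →L[ℂ] E))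
    (hK : ∀ e : X →₀ E, 0 ≤ (∑ᶠ x, ∑ᶠ y, ⟪e x, K x y (e y)⟫).re ∧
      (∑ᶠ x, ∑ᶠ y, ⟪e x, K x y (e y)⟫).im = 0) :
    K.PosSemidef := by
  simp only [finsum_finsum_inner_eq] at hK
  have hreal (x y : X) (a b : E) : ⟪a, K x y b⟫.im + ⟪b, K y x a⟫.im = 0 := by
    have hx := (hK (Finsupp.single x a)).2
    have hy := (hK (Finsupp.single y b)).2
    have hxy := (hK (Finsupp.single x a + Finsupp.single y b)).2
    rw [sum_single_add_single] at hxy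
    simp at hx hy hxy
    linarith
  have hiff := (posSemidef_tfae (K := K)).out 0 2
  refine hiff.mpr ⟨?_, fun e ↦ ?_⟩
  · ext1 x y
    rw [Matrix.conjTranspose_apply]
    refine ContinuousLinearMap.ext fun b ↦ ext_inner_left ℂ fun a ↦ ?_
    rw [ContinuousLinearMap.star_eq_adjoint, ContinuousLinearMap.adjoint_inner_right,
      ← inner_conj_symm]
    have h₁ := hreal x y a b
    have h₂ := hreal x y (Complex.I • a) b
    simp at h₂
    refine Complex.ext ?_ ?_
    · rw [Complex.conj_re]; linarith
    · rw [Complex.conj_im]; linarith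
  · rw [Finsupp.sum_comm]
    have := (hK e).1
    rw [← Complex.conj_re] at this
    simp only [map_finsuppSum, inner_conj_symm] at this
    exact this

variable {K : Matrix X X (E →L[ℂ] E)} [CompleteSpace E] [Fact K.PosSemidef]

lemma inner_kerFun_ofKernel (x y : X) (a b : E) :
    ⟪kerFun (OfKernel K) x a, kerFun (OfKernel K) y b⟫ = ⟪a, K x y b⟫ := by
  rw [kerFun_inner, kerFun_apply, OfKernel.kernel_ofKernel]

lemma span_range_kerFun_eq_top :
    (Submodule.span ℂ (Set.range fun xa : X × E ↦
      kerFun (OfKernel K) xa.1 xa.2)).topologicalClosure = ⊤ := by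
  rw [← kerFun_dense (OfKernel K)]
  congr 2
  ext
  simp

lemma ofKernel_clm_ext {T T' : OfKernel K →L[ℂ] OfKernel K}
    (h : ∀ x a, T (kerFun (OfKernel K) x a) = T' (kerFun (OfKernel K) x a)) : T = T' :=
  ContinuousLinearMap.ext_on
    (Submodule.dense_iff_topologicalClosure_eq_top.mpr span_range_kerFun_eq_top) <| by
      rintro _ ⟨xa, rfl⟩
      exact h _ _

lemma exists_ofKernel_isometry (φ : X → X) (hφ : ∀ x y, K (φ x) (φ y) = K x y) :
    ∃ T : OfKernel K →L[ℂ] OfKernel K, star T * T = 1 ∧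
      ∀ x a, T (kerFun (OfKernel K) x a) = kerFun (OfKernel K) (φ x) a := by
  obtain ⟨T, hT, hT'⟩ := exists_linearIsometry_of_inner_eq
    (fun xa : X × E ↦ kerFun (OfKernel K) xa.1 xa.2)
    (fun xa : X × E ↦ kerFun (OfKernel K) (φ xa.1) xa.2) span_range_kerFun_eq_top
    fun _ _ ↦ by simp only [inner_kerFun_ofKernel, hφ]
  exact ⟨T, star_mul_self_eq_one_of_norm_map hT, fun x a ↦ hT' (x, a)⟩

/-- A group of symmetries of a positive semidefinite kernel acts unitarily on its Hilbert space. -/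
lemma exists_ofKernel_unitary {G : Type*} [Group G] [MulAction G X]
    (hK : ∀ (γ : G) x y, K (γ • x) (γ • y) = K x y) :
    ∃ U : G →* unitary (OfKernel K →L[ℂ] OfKernel K), ∀ γ x a,
      (U γ : OfKernel K →L[ℂ] OfKernel K) (kerFun (OfKernel K) x a) =
        kerFun (OfKernel K) (γ • x) a := by
  choose U hU hU' using fun γ : G ↦ exists_ofKernel_isometry (γ • ·) (hK γ)
  have hone : U 1 = 1 := ofKernel_clm_ext fun x a ↦ by simp [hU']
  have hmul (γ δ : G) : U (γ * δ) = U γ * U δ := ofKernel_clm_ext fun x a ↦ by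
    simp [hU', mul_smul]
  have hinv (γ : G) : U γ * U γ⁻¹ = 1 := by rw [← hmul, mul_inv_cancel, hone]
  refine ⟨{ toFun := fun γ ↦ ⟨U γ, hU γ, ?_⟩
            map_one' := Subtype.ext hone
            map_mul' := fun γ δ ↦ Subtype.ext (hmul γ δ) }, hU'⟩
  rw [left_inv_eq_right_inv (hU γ) (hinv γ)]
  exact hinv γ

end Kernel

/-- The Hilbert space of a positive semidefinite function, with the left translations of the free
monoid and of the group. -/
lemma exists_kernel_representation
    {G : Type} [Group G] {E : Type} [NormedAddCommGroup E] [InnerProductSpace ℂ E]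
    [CompleteSpace E] {g : ℕ} {p : FreeGroup (Fin g) × G → (E →L[ℂ] E)} (hp : IsPSDkernel p) :
    ∃ (H : HilbertC) (k : List (Fin g) → G → E →L[ℂ] H.carrier)
      (S : Fin g → H.carrier →L[ℂ] H.carrier)
      (U : G →* unitary (H.carrier →L[ℂ] H.carrier)),
      (∀ u v γ δ a b, ⟪k u γ a, k v δ b⟫ = ⟪a, p ((wordF u)⁻¹ * wordF v, γ⁻¹ * δ) b⟫) ∧
      (∀ i, star (S i) * S i = 1) ∧ (∀ i γ, S i * U γ = U γ * S i) ∧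
      (∀ i u γ a, S i (k u γ a) = k (i :: u) γ a) ∧
      ∀ γ u δ a, (U γ : H.carrier →L[ℂ] H.carrier) (k u δ a) = k u (γ * δ) a := by
  have : Fact (hereditaryKernel p).PosSemidef := ⟨posSemidef_of_finsum_nonneg _ hp⟩
  let _ : MulAction G (List (Fin g) × G) :=
    { smul := fun γ x ↦ (x.1, γ * x.2)
      one_smul := fun x ↦ Prod.ext rfl (one_mul _)
      mul_smul := fun _ _ _ ↦ Prod.ext rfl (mul_assoc _ _ _) }
  have hsmul (γ : G) (x : List (Fin g) × G) : γ • x = (x.1, γ * x.2) := rfl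
  obtain ⟨U, hU⟩ := exists_ofKernel_unitary (G := G) (K := hereditaryKernel p) fun γ x y ↦ by
    simp [hereditaryKernel, hsmul, mul_assoc]
  choose S hS hS' using fun i : Fin g ↦ exists_ofKernel_isometry (K := hereditaryKernel p)
    (fun x ↦ (i :: x.1, x.2)) fun x y ↦ by simp [hereditaryKernel, wordF, mul_assoc]
  exact ⟨⟨OfKernel (hereditaryKernel p)⟩, fun u γ ↦ kerFun _ (u, γ), S, U,
    fun u v γ δ a b ↦ inner_kerFun_ofKernel (K := hereditaryKernel p) (u, γ) (v, δ) a b, hS,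
    fun i γ ↦ ofKernel_clm_ext fun x a ↦ by simp [hS', hU, hsmul],
    fun i u γ a ↦ hS' i (u, γ) a, fun γ u δ a ↦ hU γ (u, δ) a⟩

lemma exists_unitary_dilation
    {G : Type} [Group G] {E : Type} [NormedAddCommGroup E] [InnerProductSpace ℂ E]
    [CompleteSpace E] {g : ℕ} {p : FreeGroup (Fin g) × G → (E →L[ℂ] E)} (hp : IsPSDkernel p) :
    ∃ F : HilbertC, ∃ π : FreeGroup (Fin g) × G →* (F.carrier ≃ₗᵢ[ℂ] F.carrier),
      ∃ W : E →L[ℂ] F.carrier,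
        ∀ (u v : List (Fin g)) (γ δ : G) (ξ : E),
          p ((wordF u)⁻¹ * wordF v, γ⁻¹ * δ) ξ =
            ContinuousLinearMap.adjoint W (π ((wordF u)⁻¹ * wordF v, γ⁻¹ * δ) (W ξ)) := by
  obtain ⟨⟨H⟩, k, S, U, hk, hS, hSU, hkS, hkU⟩ := exists_kernel_representation hp
  dsimp only at k S U hk hS hSU hkS hkU
  obtain ⟨ρ, hρS, hρU⟩ := exists_unitary_extension U S hS hSU
  let π := (Unitary.linearIsometryEquiv (𝕜 := ℂ)).toMonoidHom.comp ρ
  have hmul (a b : FreeGroup (Fin g) × G) (x : WithLp 2 (H × H)) : π (a * b) x = π a (π b x) := by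
    rw [map_mul]; rfl
  have hπS (i : Fin g) (h : H) : π (FreeGroup.of i, 1) (WithLp.toLp 2 (h, 0)) =
      WithLp.toLp 2 (S i h, 0) := hρS i h
  have hπU (γ : G) (h : H) : π (1, γ) (WithLp.toLp 2 (h, 0)) =
      WithLp.toLp 2 ((U γ : H →L[ℂ] H) h, 0) := hρU γ h
  let W : E →L[ℂ] WithLp 2 (H × H) :=
    ((WithLp.prodContinuousLinearEquiv 2 ℂ H H).symm : H × H →L[ℂ] WithLp 2 (H × H)) ∘L
      ContinuousLinearMap.inl ℂ H H ∘L k [] 1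
  have hW (ξ : E) : W ξ = WithLp.toLp 2 (k [] 1 ξ, 0) := rfl
  have hπ (u : List (Fin g)) (γ : G) (ξ : E) :
      π (wordF u, γ) (W ξ) = WithLp.toLp 2 (k u γ ξ, 0) := by
    induction u with
    | nil => rw [hW]; exact (hπU γ _).trans (by rw [hkU, mul_one])
    | cons i u ih =>
      have : (wordF (i :: u), γ) = (FreeGroup.of i, 1) * (wordF u, γ) := by simp [wordF]
      rw [this, hmul, ih, hπS, hkS]
  refine ⟨⟨WithLp 2 (H × H)⟩, π, W, fun u v γ δ ξ ↦ ext_inner_left ℂ fun η ↦ ?_⟩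
  have hsplit : (wordF v, δ) = (wordF u, γ) * ((wordF u)⁻¹ * wordF v, γ⁻¹ * δ) := by simp
  rw [ContinuousLinearMap.adjoint_inner_right, ← hk,
    ← (π (wordF u, γ)).inner_map_map (W η), ← hmul,
    ← hsplit, hπ, hπ, WithLp.prod_inner_apply, inner_zero_right, add_zero]

/-- Psd functions on `Her⟨x⟩_g × G` arise from unitary representations of
`F_g × G`; if moreover `p(e) = I` the intertwiner can be chosen isometric. -/
theorem stmt14
    (G : Type) [Group G]
    (E : Type) [NormedAddCommGroup E] [InnerProductSpace ℂ E] [CompleteSpace E]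
    (g : ℕ) (hg : 0 < g)
    (p : FreeGroup (Fin g) × G → (E →L[ℂ] E))
    (hp : IsPSDkernel p) :
    (∃ F : HilbertC, ∃ π : FreeGroup (Fin g) × G →* (F.carrier ≃ₗᵢ[ℂ] F.carrier),
      ∃ W : E →L[ℂ] F.carrier,
        ∀ (u v : List (Fin g)) (γ δ : G) (ξ : E),
          p ((wordF u)⁻¹ * wordF v, γ⁻¹ * δ) ξ =
            ContinuousLinearMap.adjoint W (π ((wordF u)⁻¹ * wordF v, γ⁻¹ * δ) (W ξ))) ∧
    (p 1 = ContinuousLinearMap.id ℂ E →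
      ∃ F : HilbertC, ∃ π : FreeGroup (Fin g) × G →* (F.carrier ≃ₗᵢ[ℂ] F.carrier),
        ∃ W : E →L[ℂ] F.carrier, Isometry W ∧
          ∀ (u v : List (Fin g)) (γ δ : G) (ξ : E),
            p ((wordF u)⁻¹ * wordF v, γ⁻¹ * δ) ξ =
              ContinuousLinearMap.adjoint W (π ((wordF u)⁻¹ * wordF v, γ⁻¹ * δ) (W ξ))) := by
  obtain ⟨F, π, W, h⟩ := exists_unitary_dilation hp
  refine ⟨⟨F, π, W, h⟩, fun hone ↦ ⟨F, π, W, ?_, h⟩⟩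
  refine AddMonoidHomClass.isometry_of_norm W
    ((ContinuousLinearMap.norm_map_iff_adjoint_comp_self W).mpr ?_)
  ext ξ
  have h₁ := h [] [] 1 1 ξ
  have hw : ((wordF [])⁻¹ * wordF [], (1 : G)⁻¹ * 1) = (1 : FreeGroup (Fin g) × G) := by
    simp
  rw [hw, hone, map_one] at h₁
  exact h₁.symm
end

section
/- There exist complex numbers f₀, f₁, f₂, f₃, f₄, f₅ with the following two properties. (i) For every complex Hilbert space H and all unitary operators U₁, U₂ on H satisfying U₁³ = I and U₂² = I, the operator f₀·I + f₁·U₁ + f₂·U₁² + f₃·U₂ + f₄·U₁²U₂ + f₅·U₂U₁ is positive semidefinite. (ii) There do not exist a complex inner product space E′ and vectors q₀, q₁, q₂ ∈ E′ such that f₀ = ‖q₀‖² + ‖q₁‖² + ‖q₂‖², f₁ = ⟨q₁, q₀⟩, f₂ = ⟨q₀, q₁⟩, f₃ = ⟨q₂, q₀⟩ + ⟨q₀, q₂⟩, f₄ = ⟨q₂, q₁⟩, and f₅ = ⟨q₁, q₂⟩. -/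
open scoped ComplexInnerProductSpace

/-- A bundled complex inner product space. -/
structure InnerC : Type 1 where
  carrier : Type
  [nacg : NormedAddCommGroup carrier]
  [ips : InnerProductSpace ℂ carrier]

attribute [instance] InnerC.nacg InnerC.ips

/-- The operator `1 + U + U²` is positive semidefinite for every unitary `U` of order dividing 3,
being three times a projection. -/
theorem inner_add_add_eq_of_pow_three_eq_one {H : Type*} [NormedAddCommGroup H]
    [InnerProductSpace ℂ H] (U : H ≃ₗᵢ[ℂ] H) (hU : U ^ 3 = 1) (ξ : H) :
    ⟪ξ, ξ + U ξ + U (U ξ)⟫ = ((‖ξ + U ξ + U (U ξ)‖ ^ 2 / 3 : ℝ) : ℂ) := by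
  have hc : U (U (U ξ)) = ξ := by
    have h := DFunLike.congr_fun hU ξ
    simpa [pow_succ] using h
  have hac : ⟪U ξ, ξ⟫ = ⟪ξ, U (U ξ)⟫ := by
    have h := U.inner_map_map ξ (U (U ξ))
    rwa [hc] at h
  have hca : ⟪ξ, U ξ⟫ = ⟪U (U ξ), ξ⟫ := by
    have h := U.inner_map_map (U (U ξ)) ξ
    rwa [hc] at h
  have hsq := inner_self_eq_norm_sq_to_K (𝕜 := ℂ) (ξ + U ξ + U (U ξ))
  push_cast
  rw [eq_div_iff (by norm_num), ← Complex.coe_algebraMap, ← hsq]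
  simp only [inner_add_left, inner_add_right, U.inner_map_map]
  linear_combination hca - 2 * hac

/-- A trigonometric polynomial on `ℤ₃ * ℤ₂`, supported on
`{e, x₁, x₁², x₂, x₁²x₂, x₂x₁}`, that is positive semidefinite in every unitary
representation but admits no sum-of-squares factorization `f = q*q` with `q`
supported on `{e, x₁, x₂}`. -/
theorem stmt18 :
    ∃ f₀ f₁ f₂ f₃ f₄ f₅ : ℂ,
      (∀ (H : Type) [NormedAddCommGroup H] [InnerProductSpace ℂ H] [CompleteSpace H]
        (U₁ U₂ : H ≃ₗᵢ[ℂ] H), U₁ ^ 3 = 1 → U₂ ^ 2 = 1 →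
        ∀ ξ : H,
          0 ≤ (⟪ξ, f₀ • ξ + f₁ • U₁ ξ + f₂ • U₁ (U₁ ξ) + f₃ • U₂ ξ
                  + f₄ • U₁ (U₁ (U₂ ξ)) + f₅ • U₂ (U₁ ξ)⟫).re ∧
          (⟪ξ, f₀ • ξ + f₁ • U₁ ξ + f₂ • U₁ (U₁ ξ) + f₃ • U₂ ξ
                  + f₄ • U₁ (U₁ (U₂ ξ)) + f₅ • U₂ (U₁ ξ)⟫).im = 0) ∧
      ¬ ∃ (E : InnerC) (q₀ q₁ q₂ : E.carrier),
          f₀ = ((‖q₀‖ ^ 2 + ‖q₁‖ ^ 2 + ‖q₂‖ ^ 2 : ℝ) : ℂ) ∧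
          f₁ = ⟪q₀, q₁⟫ ∧
          f₂ = ⟪q₁, q₀⟫ ∧
          f₃ = ⟪q₀, q₂⟫ + ⟪q₂, q₀⟫ ∧
          f₄ = ⟪q₁, q₂⟫ ∧
          f₅ = ⟪q₂, q₁⟫ := by
  refine ⟨1, 1, 1, 0, 0, 0, ?_, ?_⟩
  · intro H _ _ _ U₁ U₂ h₁ _ ξ
    simp only [one_smul, zero_smul, add_zero]
    rw [inner_add_add_eq_of_pow_three_eq_one U₁ h₁ ξ, Complex.ofReal_re, Complex.ofReal_im]
    exact ⟨by positivity, rfl⟩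
  · rintro ⟨E, q₀, q₁, q₂, h₀, h₁, -⟩
    have hn : (1 : ℝ) = ‖q₀‖ ^ 2 + ‖q₁‖ ^ 2 + ‖q₂‖ ^ 2 := by exact_mod_cast h₀
    have hle : ‖(1 : ℂ)‖ ≤ ‖q₀‖ * ‖q₁‖ := h₁ ▸ norm_inner_le_norm q₀ q₁
    rw [norm_one] at hle
    nlinarith [sq_nonneg (‖q₀‖ - ‖q₁‖), sq_nonneg ‖q₂‖]
end

section
/- Let s = 1/√2. The 7×7 real matrix T₀ with rows [1,0,0,0,s,s,0], [0,1,0,0,0,0,s], [0,0,1,0,0,0,0], [0,0,0,1,0,0,0], [s,0,0,0,1,0,0], [s,0,0,0,0,1,0], [0,s,0,0,0,0,1] is positive semidefinite, but for every complex number z the 8×8 matrix T(z) with rows [1,0,0,0,s,s,0,z], [0,1,0,0,0,0,s,s], [0,0,1,0,0,0,0,s], [0,0,0,1,0,0,0,0], [s,0,0,0,1,0,0,0], [s,0,0,0,0,1,0,0], [0,s,0,0,0,0,1,0], [conj(z),s,s,0,0,0,0,1] is not positive semidefinite. -/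
open scoped ComplexOrder

/-- A partially defined psd two-variable Toeplitz matrix with no psd Toeplitz
extension: the 7×7 truncation `T₀` is psd, but no choice of the entry `z`
makes the 8×8 extension psd. -/
theorem stmt19 :
    (!![(1 : ℝ), 0, 0, 0, (Real.sqrt 2)⁻¹, (Real.sqrt 2)⁻¹, 0;
        0, 1, 0, 0, 0, 0, (Real.sqrt 2)⁻¹;
        0, 0, 1, 0, 0, 0, 0;
        0, 0, 0, 1, 0, 0, 0;
        (Real.sqrt 2)⁻¹, 0, 0, 0, 1, 0, 0;
        (Real.sqrt 2)⁻¹, 0, 0, 0, 0, 1, 0;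
        0, (Real.sqrt 2)⁻¹, 0, 0, 0, 0, 1] : Matrix (Fin 7) (Fin 7) ℝ).PosSemidef ∧
    ∀ z : ℂ,
      ¬ (!![(1 : ℂ), 0, 0, 0, ((Real.sqrt 2)⁻¹ : ℝ), ((Real.sqrt 2)⁻¹ : ℝ), 0, z;
            0, 1, 0, 0, 0, 0, ((Real.sqrt 2)⁻¹ : ℝ), ((Real.sqrt 2)⁻¹ : ℝ);
            0, 0, 1, 0, 0, 0, 0, ((Real.sqrt 2)⁻¹ : ℝ);
            0, 0, 0, 1, 0, 0, 0, 0;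
            ((Real.sqrt 2)⁻¹ : ℝ), 0, 0, 0, 1, 0, 0, 0;
            ((Real.sqrt 2)⁻¹ : ℝ), 0, 0, 0, 0, 1, 0, 0;
            0, ((Real.sqrt 2)⁻¹ : ℝ), 0, 0, 0, 0, 1, 0;
            star z, ((Real.sqrt 2)⁻¹ : ℝ), ((Real.sqrt 2)⁻¹ : ℝ), 0, 0, 0, 0, 1] :
          Matrix (Fin 8) (Fin 8) ℂ).PosSemidef := by
  have hs : (Real.sqrt 2)⁻¹ ^ 2 = 1 / 2 := by
    rw [inv_pow, Real.sq_sqrt zero_le_two, one_div]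
  have hs' : 0 < (Real.sqrt 2)⁻¹ := by positivity
  set s : ℝ := (Real.sqrt 2)⁻¹
  refine ⟨Matrix.PosSemidef.of_dotProduct_mulVec_nonneg ?_ fun x => ?_, fun z h => ?_⟩
  · ext i j
    fin_cases i <;> fin_cases j <;> simp
  · simp [dotProduct, Matrix.mulVec, Fin.sum_univ_succ]
    linear_combination (norm := skip) sq_nonneg (x 4 + s * x 0) + sq_nonneg (x 5 + s * x 0) +
      sq_nonneg (x 6 + s * x 1) + sq_nonneg (x 1) / 2 + sq_nonneg (x 2) + sq_nonneg (x 3) +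
      (2 * x 0 ^ 2 + x 1 ^ 2) * hs
    ring_nf
    rfl
  · have key := h.dotProduct_mulVec_nonneg ![0, 1, (s : ℂ), 0, 0, 0, -(s : ℂ), -1]
    simp [dotProduct, Matrix.mulVec, Fin.sum_univ_succ] at key
    norm_cast at key
    nlinarith
end
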